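/- Let i, j ∈ ℂ satisfy i² = −1 and j² + j + 1 = 0, and define the five 2-dimensional subspaces of ℂ⁵: π₁ = span{(1,0,0,i,0), (0,1,0,0,i)}, π₂ = span{(1,0,0,−i,0), (0,1,0,0,−i)}, π₃ = span{(0,1,0,1,0), (1,0,1,0,1)}, π₄ = span{(0,1,0,j²,0), (1,0,j²,0,j)}, π₅ = span{(0,1,0,j,0), (1,0,j,0,j²)}. Then for every permutation (p,q,r,s,t) of (1,2,3,4,5), the subspaces π_p ⊓ (π_q ⊔ π_r) and π_p ⊓ (π_s ⊔ π_t) of ℂ⁵ are equal. (Thus the thirty intersection points p_{ijk} = π_i ∩ (π_j + π_k) coincide in pairs, giving only fifteen points.) -/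

import Mathlib

/-- The five special planes `π₁, …, π₅` of `ℂ⁵` attached to Ozeki's tensor, where
`i² = −1` and `j² + j + 1 = 0`. -/
noncomputable def segrePlanes (i j : ℂ) : Fin 5 → Submodule ℂ (Fin 5 → ℂ) :=
  ![Submodule.span ℂ ({![1, 0, 0, i, 0], ![0, 1, 0, 0, i]} : Set (Fin 5 → ℂ)),
    Submodule.span ℂ ({![1, 0, 0, -i, 0], ![0, 1, 0, 0, -i]} : Set (Fin 5 → ℂ)),
    Submodule.span ℂ ({![0, 1, 0, 1, 0], ![1, 0, 1, 0, 1]} : Set (Fin 5 → ℂ)),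
    Submodule.span ℂ ({![0, 1, 0, j ^ 2, 0], ![1, 0, j ^ 2, 0, j]} : Set (Fin 5 → ℂ)),
    Submodule.span ℂ ({![0, 1, 0, j, 0], ![1, 0, j, 0, j ^ 2]} : Set (Fin 5 → ℂ))]

/-- Two planes spanning a hyperplane: `f` is an equation of the hyperplane, and
`a, b, c, d` are the coordinates of its points. -/
theorem mem_sup_iff {u v w z : Fin 5 → ℂ} (f a b c d : (Fin 5 → ℂ) → ℂ)
    (hf : ∀ α β γ δ : ℂ, f ((α • u + β • v) + (γ • w + δ • z)) = 0)
    (hx : ∀ x, f x = 0 → ∀ k, ((a x • u + b x • v) + (c x • w + d x • z)) k = x k)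
    (x : Fin 5 → ℂ) :
    x ∈ Submodule.span ℂ {u, v} ⊔ Submodule.span ℂ {w, z} ↔ f x = 0 := by
  simp only [Submodule.mem_sup, Submodule.mem_span_pair]
  constructor
  · rintro ⟨_, ⟨α, β, rfl⟩, _, ⟨γ, δ, rfl⟩, rfl⟩
    exact hf α β γ δ
  · intro h
    exact ⟨_, ⟨_, _, rfl⟩, _, ⟨_, _, rfl⟩, funext (hx x h)⟩

/-- If the equations of two subspaces are proportional on a plane, then the two subspaces
cut the plane in the same subspace. -/
theorem inf_eq {u v : Fin 5 → ℂ} {A B : Submodule ℂ (Fin 5 → ℂ)} {f g : (Fin 5 → ℂ) → ℂ}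
    (hA : ∀ x, x ∈ A ↔ f x = 0) (hB : ∀ x, x ∈ B ↔ g x = 0) (c d : ℂ) (h : c * d = 1)
    (hfg : ∀ α β : ℂ, f (α • u + β • v) = c * g (α • u + β • v)) :
    Submodule.span ℂ {u, v} ⊓ A = Submodule.span ℂ {u, v} ⊓ B := by
  have hc : c ≠ 0 := left_ne_zero_of_mul_eq_one h
  ext x
  rw [Submodule.mem_inf, Submodule.mem_inf, hA, hB]
  refine and_congr_right fun hx => ?_
  obtain ⟨α, β, rfl⟩ := Submodule.mem_span_pair.1 hx
  simp [hfg, hc]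

/-- The coincidence of the points `p_{pqr}` and `p_{pst}`. -/
def Coincide (i j : ℂ) (p q r s t : Fin 5) : Prop :=
  segrePlanes i j p ⊓ (segrePlanes i j q ⊔ segrePlanes i j r) =
    segrePlanes i j p ⊓ (segrePlanes i j s ⊔ segrePlanes i j t)

section computations

variable {i j : ℂ}

theorem mem_sup_0_1 (hi : i ^ 2 = -1) (hj : j ^ 2 + j + 1 = 0) (x : Fin 5 → ℂ) :
    x ∈ segrePlanes i j 0 ⊔ segrePlanes i j 1 ↔ ((1)) * x 2 = 0 :=
  mem_sup_iff (fun x => ((1)) * x 2)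
    (fun x => ((1/2)) * x 0 + ((-1/2)*i) * x 3)
    (fun x => ((1/2)) * x 1 + ((-1/2)*i) * x 4)
    (fun x => ((1/2)) * x 0 + ((1/2)*i) * x 3)
    (fun x => ((1/2)) * x 1 + ((1/2)*i) * x 4)
    (by intros; simp <;> grind) (by intro x h k; fin_cases k <;> simp <;> grind) x

theorem mem_sup_0_2 (hi : i ^ 2 = -1) (hj : j ^ 2 + j + 1 = 0) (x : Fin 5 → ℂ) :
    x ∈ segrePlanes i j 0 ⊔ segrePlanes i j 2 ↔ ((1)) * x 0 + ((-1)*i) * x 1 + ((-2)) * x 2 + ((1)*i) * x 3 + ((1)) * x 4 = 0 :=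
  mem_sup_iff (fun x => ((1)) * x 0 + ((-1)*i) * x 1 + ((-2)) * x 2 + ((1)*i) * x 3 + ((1)) * x 4)
    (fun x => ((1)) * x 0 + ((-1)) * x 2)
    (fun x => ((1)*i) * x 0 + ((1)) * x 1 + ((-1)*i) * x 2 + ((-1)) * x 3)
    (fun x => ((-1)*i) * x 0 + ((1)*i) * x 2 + ((1)) * x 3)
    (fun x => ((1)) * x 2)
    (by intros; simp <;> grind) (by intro x h k; fin_cases k <;> simp <;> grind) x

theorem mem_sup_0_3 (hi : i ^ 2 = -1) (hj : j ^ 2 + j + 1 = 0) (x : Fin 5 → ℂ) :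
    x ∈ segrePlanes i j 0 ⊔ segrePlanes i j 3 ↔ ((1)*j) * x 0 + ((-1)*i) * x 1 + ((2)+(2)*j) * x 2 + ((1)*i*j) * x 3 + ((1)) * x 4 = 0 :=
  mem_sup_iff (fun x => ((1)*j) * x 0 + ((-1)*i) * x 1 + ((2)+(2)*j) * x 2 + ((1)*i*j) * x 3 + ((1)) * x 4)
    (fun x => ((1)) * x 0 + ((-1)*j) * x 2)
    (fun x => ((1)*i*j) * x 0 + ((1)) * x 1 + ((1)*i+(1)*i*j) * x 2 + ((-1)*j) * x 3)
    (fun x => ((-1)*i*j) * x 0 + ((-1)*i+(-1)*i*j) * x 2 + ((1)*j) * x 3)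
    (fun x => ((1)*j) * x 2)
    (by intros; simp <;> grind) (by intro x h k; fin_cases k <;> simp <;> grind) x

theorem mem_sup_0_4 (hi : i ^ 2 = -1) (hj : j ^ 2 + j + 1 = 0) (x : Fin 5 → ℂ) :
    x ∈ segrePlanes i j 0 ⊔ segrePlanes i j 4 ↔ ((-1)+(-1)*j) * x 0 + ((-1)*i) * x 1 + ((-2)*j) * x 2 + ((-1)*i+(-1)*i*j) * x 3 + ((1)) * x 4 = 0 :=
  mem_sup_iff (fun x => ((-1)+(-1)*j) * x 0 + ((-1)*i) * x 1 + ((-2)*j) * x 2 + ((-1)*i+(-1)*i*j) * x 3 + ((1)) * x 4)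
    (fun x => ((1)) * x 0 + ((1)+(1)*j) * x 2)
    (fun x => ((-1)*i+(-1)*i*j) * x 0 + ((1)) * x 1 + ((-1)*i*j) * x 2 + ((1)+(1)*j) * x 3)
    (fun x => ((1)*i+(1)*i*j) * x 0 + ((1)*i*j) * x 2 + ((-1)+(-1)*j) * x 3)
    (fun x => ((-1)+(-1)*j) * x 2)
    (by intros; simp <;> grind) (by intro x h k; fin_cases k <;> simp <;> grind) x

theorem mem_sup_1_2 (hi : i ^ 2 = -1) (hj : j ^ 2 + j + 1 = 0) (x : Fin 5 → ℂ) :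
    x ∈ segrePlanes i j 1 ⊔ segrePlanes i j 2 ↔ ((1)) * x 0 + ((1)*i) * x 1 + ((-2)) * x 2 + ((-1)*i) * x 3 + ((1)) * x 4 = 0 :=
  mem_sup_iff (fun x => ((1)) * x 0 + ((1)*i) * x 1 + ((-2)) * x 2 + ((-1)*i) * x 3 + ((1)) * x 4)
    (fun x => ((1)) * x 0 + ((-1)) * x 2)
    (fun x => ((-1)*i) * x 0 + ((1)) * x 1 + ((1)*i) * x 2 + ((-1)) * x 3)
    (fun x => ((1)*i) * x 0 + ((-1)*i) * x 2 + ((1)) * x 3)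
    (fun x => ((1)) * x 2)
    (by intros; simp <;> grind) (by intro x h k; fin_cases k <;> simp <;> grind) x

theorem mem_sup_1_3 (hi : i ^ 2 = -1) (hj : j ^ 2 + j + 1 = 0) (x : Fin 5 → ℂ) :
    x ∈ segrePlanes i j 1 ⊔ segrePlanes i j 3 ↔ ((1)*j) * x 0 + ((1)*i) * x 1 + ((2)+(2)*j) * x 2 + ((-1)*i*j) * x 3 + ((1)) * x 4 = 0 :=
  mem_sup_iff (fun x => ((1)*j) * x 0 + ((1)*i) * x 1 + ((2)+(2)*j) * x 2 + ((-1)*i*j) * x 3 + ((1)) * x 4)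
    (fun x => ((1)) * x 0 + ((-1)*j) * x 2)
    (fun x => ((-1)*i*j) * x 0 + ((1)) * x 1 + ((-1)*i+(-1)*i*j) * x 2 + ((-1)*j) * x 3)
    (fun x => ((1)*i*j) * x 0 + ((1)*i+(1)*i*j) * x 2 + ((1)*j) * x 3)
    (fun x => ((1)*j) * x 2)
    (by intros; simp <;> grind) (by intro x h k; fin_cases k <;> simp <;> grind) x

theorem mem_sup_1_4 (hi : i ^ 2 = -1) (hj : j ^ 2 + j + 1 = 0) (x : Fin 5 → ℂ) :
    x ∈ segrePlanes i j 1 ⊔ segrePlanes i j 4 ↔ ((-1)+(-1)*j) * x 0 + ((1)*i) * x 1 + ((-2)*j) * x 2 + ((1)*i+(1)*i*j) * x 3 + ((1)) * x 4 = 0 :=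
  mem_sup_iff (fun x => ((-1)+(-1)*j) * x 0 + ((1)*i) * x 1 + ((-2)*j) * x 2 + ((1)*i+(1)*i*j) * x 3 + ((1)) * x 4)
    (fun x => ((1)) * x 0 + ((1)+(1)*j) * x 2)
    (fun x => ((1)*i+(1)*i*j) * x 0 + ((1)) * x 1 + ((1)*i*j) * x 2 + ((1)+(1)*j) * x 3)
    (fun x => ((-1)*i+(-1)*i*j) * x 0 + ((-1)*i*j) * x 2 + ((-1)+(-1)*j) * x 3)
    (fun x => ((-1)+(-1)*j) * x 2)
    (by intros; simp <;> grind) (by intro x h k; fin_cases k <;> simp <;> grind) x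

theorem mem_sup_2_3 (hi : i ^ 2 = -1) (hj : j ^ 2 + j + 1 = 0) (x : Fin 5 → ℂ) :
    x ∈ segrePlanes i j 2 ⊔ segrePlanes i j 3 ↔ ((-1)+(-1)*j) * x 0 + ((1)*j) * x 2 + ((1)) * x 4 = 0 :=
  mem_sup_iff (fun x => ((-1)+(-1)*j) * x 0 + ((1)*j) * x 2 + ((1)) * x 4)
    (fun x => ((2/3)+(1/3)*j) * x 1 + ((1/3)+(-1/3)*j) * x 3)
    (fun x => ((2/3)+(1/3)*j) * x 0 + ((1/3)+(-1/3)*j) * x 2)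
    (fun x => ((1/3)+(-1/3)*j) * x 1 + ((-1/3)+(1/3)*j) * x 3)
    (fun x => ((1/3)+(-1/3)*j) * x 0 + ((-1/3)+(1/3)*j) * x 2)
    (by intros; simp <;> grind) (by intro x h k; fin_cases k <;> simp <;> grind) x

theorem mem_sup_2_4 (hi : i ^ 2 = -1) (hj : j ^ 2 + j + 1 = 0) (x : Fin 5 → ℂ) :
    x ∈ segrePlanes i j 2 ⊔ segrePlanes i j 4 ↔ ((1)*j) * x 0 + ((-1)+(-1)*j) * x 2 + ((1)) * x 4 = 0 :=
  mem_sup_iff (fun x => ((1)*j) * x 0 + ((-1)+(-1)*j) * x 2 + ((1)) * x 4)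
    (fun x => ((1/3)+(-1/3)*j) * x 1 + ((2/3)+(1/3)*j) * x 3)
    (fun x => ((1/3)+(-1/3)*j) * x 0 + ((2/3)+(1/3)*j) * x 2)
    (fun x => ((2/3)+(1/3)*j) * x 1 + ((-2/3)+(-1/3)*j) * x 3)
    (fun x => ((2/3)+(1/3)*j) * x 0 + ((-2/3)+(-1/3)*j) * x 2)
    (by intros; simp <;> grind) (by intro x h k; fin_cases k <;> simp <;> grind) x

theorem mem_sup_3_4 (hi : i ^ 2 = -1) (hj : j ^ 2 + j + 1 = 0) (x : Fin 5 → ℂ) :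
    x ∈ segrePlanes i j 3 ⊔ segrePlanes i j 4 ↔ ((1)) * x 0 + ((1)) * x 2 + ((1)) * x 4 = 0 :=
  mem_sup_iff (fun x => ((1)) * x 0 + ((1)) * x 2 + ((1)) * x 4)
    (fun x => ((2/3)+(1/3)*j) * x 1 + ((1/3)+(2/3)*j) * x 3)
    (fun x => ((2/3)+(1/3)*j) * x 0 + ((1/3)+(2/3)*j) * x 2)
    (fun x => ((1/3)+(-1/3)*j) * x 1 + ((-1/3)+(-2/3)*j) * x 3)
    (fun x => ((1/3)+(-1/3)*j) * x 0 + ((-1/3)+(-2/3)*j) * x 2)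
    (by intros; simp <;> grind) (by intro x h k; fin_cases k <;> simp <;> grind) x

theorem inf_0_1_2 (hi : i ^ 2 = -1) (hj : j ^ 2 + j + 1 = 0) :
    Coincide i j 0 1 2 3 4 :=
  inf_eq (mem_sup_1_2 hi hj) (mem_sup_3_4 hi hj)
    ((2)) ((1/2)) (by grind) (by intros; simp; grind)

theorem inf_0_1_3 (hi : i ^ 2 = -1) (hj : j ^ 2 + j + 1 = 0) :
    Coincide i j 0 1 3 2 4 :=
  inf_eq (mem_sup_1_3 hi hj) (mem_sup_2_4 hi hj)
    ((2)) ((1/2)) (by grind) (by intros; simp; grind)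

theorem inf_0_1_4 (hi : i ^ 2 = -1) (hj : j ^ 2 + j + 1 = 0) :
    Coincide i j 0 1 4 2 3 :=
  inf_eq (mem_sup_1_4 hi hj) (mem_sup_2_3 hi hj)
    ((2)) ((1/2)) (by grind) (by intros; simp; grind)

theorem inf_1_0_2 (hi : i ^ 2 = -1) (hj : j ^ 2 + j + 1 = 0) :
    Coincide i j 1 0 2 3 4 :=
  inf_eq (mem_sup_0_2 hi hj) (mem_sup_3_4 hi hj)
    ((2)) ((1/2)) (by grind) (by intros; simp; grind)

theorem inf_1_0_3 (hi : i ^ 2 = -1) (hj : j ^ 2 + j + 1 = 0) :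
    Coincide i j 1 0 3 2 4 :=
  inf_eq (mem_sup_0_3 hi hj) (mem_sup_2_4 hi hj)
    ((2)) ((1/2)) (by grind) (by intros; simp; grind)

theorem inf_1_0_4 (hi : i ^ 2 = -1) (hj : j ^ 2 + j + 1 = 0) :
    Coincide i j 1 0 4 2 3 :=
  inf_eq (mem_sup_0_4 hi hj) (mem_sup_2_3 hi hj)
    ((2)) ((1/2)) (by grind) (by intros; simp; grind)

theorem inf_2_0_1 (hi : i ^ 2 = -1) (hj : j ^ 2 + j + 1 = 0) :
    Coincide i j 2 0 1 3 4 :=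
  inf_eq (mem_sup_0_1 hi hj) (mem_sup_3_4 hi hj)
    ((1/3)) ((3)) (by grind) (by intros; simp; grind)

theorem inf_2_0_3 (hi : i ^ 2 = -1) (hj : j ^ 2 + j + 1 = 0) :
    Coincide i j 2 0 3 1 4 :=
  inf_eq (mem_sup_0_3 hi hj) (mem_sup_1_4 hi hj)
    ((1)*j) ((-1)+(-1)*j) (by grind) (by intros; simp; grind)

theorem inf_2_0_4 (hi : i ^ 2 = -1) (hj : j ^ 2 + j + 1 = 0) :
    Coincide i j 2 0 4 1 3 :=
  inf_eq (mem_sup_0_4 hi hj) (mem_sup_1_3 hi hj)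
    ((-1)+(-1)*j) ((1)*j) (by grind) (by intros; simp; grind)

theorem inf_3_0_1 (hi : i ^ 2 = -1) (hj : j ^ 2 + j + 1 = 0) :
    Coincide i j 3 0 1 2 4 :=
  inf_eq (mem_sup_0_1 hi hj) (mem_sup_2_4 hi hj)
    ((1/3)*j) ((-3)+(-3)*j) (by grind) (by intros; simp; grind)

theorem inf_3_0_2 (hi : i ^ 2 = -1) (hj : j ^ 2 + j + 1 = 0) :
    Coincide i j 3 0 2 1 4 :=
  inf_eq (mem_sup_0_2 hi hj) (mem_sup_1_4 hi hj)
    ((-1)+(-1)*j) ((1)*j) (by grind) (by intros; simp; grind)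

theorem inf_3_0_4 (hi : i ^ 2 = -1) (hj : j ^ 2 + j + 1 = 0) :
    Coincide i j 3 0 4 1 2 :=
  inf_eq (mem_sup_0_4 hi hj) (mem_sup_1_2 hi hj)
    ((1)*j) ((-1)+(-1)*j) (by grind) (by intros; simp; grind)

theorem inf_4_0_1 (hi : i ^ 2 = -1) (hj : j ^ 2 + j + 1 = 0) :
    Coincide i j 4 0 1 2 3 :=
  inf_eq (mem_sup_0_1 hi hj) (mem_sup_2_3 hi hj)
    ((-1/3)+(-1/3)*j) ((3)*j) (by grind) (by intros; simp; grind)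

theorem inf_4_0_2 (hi : i ^ 2 = -1) (hj : j ^ 2 + j + 1 = 0) :
    Coincide i j 4 0 2 1 3 :=
  inf_eq (mem_sup_0_2 hi hj) (mem_sup_1_3 hi hj)
    ((1)*j) ((-1)+(-1)*j) (by grind) (by intros; simp; grind)

theorem inf_4_0_3 (hi : i ^ 2 = -1) (hj : j ^ 2 + j + 1 = 0) :
    Coincide i j 4 0 3 1 2 :=
  inf_eq (mem_sup_0_3 hi hj) (mem_sup_1_2 hi hj)
    ((-1)+(-1)*j) ((1)*j) (by grind) (by intros; simp; grind)

end computations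

theorem all_of_fifteen (P : Fin 5 → Fin 5 → Fin 5 → Fin 5 → Fin 5 → Prop)
    (h1 : ∀ p q r s t, P p q r s t → P p r q s t)
    (h2 : ∀ p q r s t, P p q r s t → P p s t q r)
    (b0 : P 0 1 2 3 4)
    (b1 : P 0 1 3 2 4)
    (b2 : P 0 1 4 2 3)
    (b3 : P 1 0 2 3 4)
    (b4 : P 1 0 3 2 4)
    (b5 : P 1 0 4 2 3)
    (b6 : P 2 0 1 3 4)
    (b7 : P 2 0 3 1 4)
    (b8 : P 2 0 4 1 3)
    (b9 : P 3 0 1 2 4)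
    (b10 : P 3 0 2 1 4)
    (b11 : P 3 0 4 1 2)
    (b12 : P 4 0 1 2 3)
    (b13 : P 4 0 2 1 3)
    (b14 : P 4 0 3 1 2)
    (e : Equiv.Perm (Fin 5)) : P (e 0) (e 1) (e 2) (e 3) (e 4) := by
  have h3 : ∀ p q r s t, P p q r s t → P p q r t s := fun p q r s t h =>
    h2 _ _ _ _ _ (h1 _ _ _ _ _ (h2 _ _ _ _ _ h))
  suffices H : ∀ p q r s t : Fin 5, [p, q, r, s, t].Nodup → P p q r s t by
    refine H _ _ _ _ _ ?_
    simp
  have key : ∀ p q r s t : Fin 5, [p, q, r, s, t].Nodup → q < r → s < t → q < s →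
      P p q r s t := by
    have T : ∀ p q r s t : Fin 5, [p, q, r, s, t].Nodup → q < r → s < t → q < s →
      (p, q, r, s, t) ∈ [(0, 1, 2, 3, 4), (0, 1, 3, 2, 4), (0, 1, 4, 2, 3), (1, 0, 2, 3, 4), (1, 0, 3, 2, 4), (1, 0, 4, 2, 3), (2, 0, 1, 3, 4), (2, 0, 3, 1, 4), (2, 0, 4, 1, 3), (3, 0, 1, 2, 4), (3, 0, 2, 1, 4), (3, 0, 4, 1, 2), (4, 0, 1, 2, 3), (4, 0, 2, 1, 3), (4, 0, 3, 1, 2)] := by decide +kernel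
    intro p q r s t h a b c
    have := T p q r s t h a b c
    simp only [List.mem_cons, Prod.mk.injEq, List.not_mem_nil, or_false] at this
    clear h1 h2 h3 T
    aesop
  have key2 : ∀ p q r s t : Fin 5, [p, q, r, s, t].Nodup → q < r → s < t → P p q r s t := by
    intro p q r s t h a b
    rcases lt_trichotomy q s with c | c | c
    · exact key _ _ _ _ _ h a b c
    · simp [c] at h
    · exact h2 _ _ _ _ _ (key _ _ _ _ _ (by simp at h ⊢; grind) b a c)
  have key3 : ∀ p q r s t : Fin 5, [p, q, r, s, t].Nodup → q < r → P p q r s t := by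
    intro p q r s t h a
    rcases lt_trichotomy s t with c | c | c
    · exact key2 _ _ _ _ _ h a c
    · simp [c] at h
    · exact h3 _ _ _ _ _ (key2 _ _ _ _ _ (by simp at h ⊢; grind) a c)
  intro p q r s t h
  rcases lt_trichotomy q r with c | c | c
  · exact key3 _ _ _ _ _ h c
  · simp [c] at h
  · exact h1 _ _ _ _ _ (key3 _ _ _ _ _ (by simp at h ⊢; grind) c)

/-- For every permutation `(p,q,r,s,t)` of the five planes,
`π_p ∩ (π_q + π_r) = π_p ∩ (π_s + π_t)`: the thirty points coincide in pairs, giving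
only fifteen points. -/
theorem thirty_points_coincide_in_pairs (i j : ℂ) (hi : i ^ 2 = -1)
    (hj : j ^ 2 + j + 1 = 0) (e : Equiv.Perm (Fin 5)) :
    segrePlanes i j (e 0) ⊓ (segrePlanes i j (e 1) ⊔ segrePlanes i j (e 2)) =
      segrePlanes i j (e 0) ⊓ (segrePlanes i j (e 3) ⊔ segrePlanes i j (e 4)) := by
  refine all_of_fifteen (Coincide i j) ?_ ?_
    (inf_0_1_2 hi hj)
    (inf_0_1_3 hi hj)
    (inf_0_1_4 hi hj)
    (inf_1_0_2 hi hj)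
    (inf_1_0_3 hi hj)
    (inf_1_0_4 hi hj)
    (inf_2_0_1 hi hj)
    (inf_2_0_3 hi hj)
    (inf_2_0_4 hi hj)
    (inf_3_0_1 hi hj)
    (inf_3_0_2 hi hj)
    (inf_3_0_4 hi hj)
    (inf_4_0_1 hi hj)
    (inf_4_0_2 hi hj)
    (inf_4_0_3 hi hj) e
  · intro p q r s t h
    unfold Coincide
    rw [sup_comm (segrePlanes i j r)]
    exact h
  · intro p q r s t h
    exact h.symm
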